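/- Let X be a covariate random vector, D and Z be {0,1}-valued indicator random variables, and Y^{tv} a real potential outcome with E|Y^{tv}| < ∞. Define e(X) = P(D=1 | X) and π(X) = P(Z=1 | D=1, X), and suppose almost surely 0 < e(X) < 1 and 0 < π(X) < 1 (positivity). Assume Y^{tv} is conditionally independent of (D, Z) given X (weak conditional exchangeability), and that the observed outcome Y satisfies Y = Y^{tv} on the event {D=1, Z=1} (consistency). Then E[Y^{tv}] = E[ (D·Z / (e(X)·π(X))) · Y ]. -/

import Mathlib

open MeasureTheory ProbabilityTheory

/-- Integrating a sub-sigma-algebra measurable function over a set. -/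
lemma lintegral_restrict_eq_condExp {Ω : Type*} {m mΩ : MeasurableSpace Ω}
    {μ : Measure Ω} [IsProbabilityMeasure μ] (hm : m ≤ mΩ) {S : Set Ω} (hS : MeasurableSet S)
    (g : Ω → ENNReal) (hg : Measurable[m] g) :
    ∫⁻ ω in S, g ω ∂μ = ∫⁻ ω, ENNReal.ofReal ((μ⟦S | m⟧) ω) * g ω ∂μ := by
  have hc : StronglyMeasurable[m] (μ⟦S | m⟧) := stronglyMeasurable_condExp
  have hcm : Measurable (fun ω => ENNReal.ofReal ((μ⟦S | m⟧) ω)) :=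
    (hc.mono hm).measurable.ennreal_ofReal
  have hc0 : 0 ≤ᵐ[μ] μ⟦S | m⟧ :=
    condExp_nonneg (ae_of_all _ fun ω => Set.indicator_nonneg (fun _ _ => zero_le_one) ω)
  have hI : Integrable (S.indicator (fun _ => (1 : ℝ))) μ :=
    (integrable_const (1 : ℝ)).indicator hS
  have key : (μ.restrict S).trim hm
      = (μ.withDensity (fun ω => ENNReal.ofReal ((μ⟦S | m⟧) ω))).trim hm := by
    refine @Measure.ext _ m _ _ fun t ht => ?_
    rw [trim_measurableSet_eq hm ht, trim_measurableSet_eq hm ht,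
      withDensity_apply _ (hm t ht), Measure.restrict_apply (hm t ht),
      ← ofReal_integral_eq_lintegral_ofReal integrable_condExp.integrableOn
        (ae_restrict_of_ae hc0), setIntegral_condExp hm hI ht,
      integral_indicator hS, Measure.restrict_restrict hS, setIntegral_const]
    simp [Set.inter_comm]
  rw [← lintegral_trim hm hg, key, lintegral_trim hm hg,
    lintegral_withDensity_eq_lintegral_mul _ hcm (hg.mono hm le_rfl)]
  rfl

/-- Proposition 2 of the paper: inverse probability weighting
identification of the version-specific mean potential outcome
`E[Y^{tv}] = E[ D·Z·Y / (e(X)·π(X)) ]`. -/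
theorem ipw_identification
    {Ω : Type*} [mΩ : MeasurableSpace Ω] [StandardBorelSpace Ω] [Nonempty Ω]
    {μ : Measure Ω} [IsProbabilityMeasure μ] {p : ℕ}
    (X : Ω → (Fin p → ℝ)) (D Z Ypo Y : Ω → ℝ)
    (e pi : (Fin p → ℝ) → ℝ)
    (hX : Measurable X) (hD : Measurable D) (hZ : Measurable Z)
    (hYpo : Measurable Ypo) (hY : Measurable Y)
    (he : Measurable e) (hpi : Measurable pi)
    -- indicator structure: D, Z ∈ {0,1} and Z = 1 implies D = 1
    (hDval : ∀ ω, D ω = 0 ∨ D ω = 1)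
    (hZval : ∀ ω, Z ω = 0 ∨ Z ω = 1)
    (hZD : ∀ ω, Z ω = 1 → D ω = 1)
    -- integrability of the potential outcome
    (hint : Integrable Ypo μ)
    -- the generalized propensity score: e(X) = P(D=1|X) and
    -- e(X)·π(X) = P(D=1, Z=1|X)  (π(X) = P(Z=1|D=1,X))
    (hescore : (fun ω => e (X ω))
        =ᵐ[μ] μ[D | MeasurableSpace.comap X inferInstance])
    (hpiscore : μ[fun ω => D ω * Z ω | MeasurableSpace.comap X inferInstance]
        =ᵐ[μ] fun ω => e (X ω) * pi (X ω))
    -- positivity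
    (hpos : ∀ᵐ ω ∂μ, 0 < e (X ω) ∧ e (X ω) < 1 ∧ 0 < pi (X ω) ∧ pi (X ω) < 1)
    -- weak conditional exchangeability: Y^{tv} ⫫ (D,Z) | X
    (hexch : CondIndepFun (MeasurableSpace.comap X inferInstance) hX.comap_le
        Ypo (fun ω => (D ω, Z ω)) μ)
    -- consistency: Y = Y^{tv} on {D=1, Z=1}
    (hcons : ∀ ω, D ω = 1 → Z ω = 1 → Y ω = Ypo ω) :
    ∫ ω, Ypo ω ∂μ
      = ∫ ω, (D ω * Z ω / (e (X ω) * pi (X ω))) * Y ω ∂μ := by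
  have hm : MeasurableSpace.comap X inferInstance ≤ mΩ := hX.comap_le
  have hXm : Measurable[MeasurableSpace.comap X inferInstance] X := comap_measurable X
  set A : Set Ω := (fun ω => (D ω, Z ω)) ⁻¹' {(1, 1)} with hA
  have hAm : MeasurableSet A := (hD.prodMk hZ) (measurableSet_singleton _)
  have hDZ : (fun ω => D ω * Z ω) = A.indicator (fun _ => (1 : ℝ)) := by
    funext ω
    rcases hDval ω with h | h <;> rcases hZval ω with h' | h' <;>
      simp [hA, Set.indicator, h, h']
  let g : Ω → ENNReal := fun ω => ENNReal.ofReal ((e (X ω) * pi (X ω))⁻¹)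
  have hg : Measurable[MeasurableSpace.comap X inferInstance] g :=
    (((he.mul hpi).inv).ennreal_ofReal).comp hXm
  have hgm : Measurable g := hg.mono hm le_rfl
  have hlaw : ((μ.restrict A).withDensity g).map Ypo = μ.map Ypo := by
    ext B hB
    have hS : MeasurableSet (Ypo ⁻¹' B) := hYpo hB
    rw [Measure.map_apply hYpo hB, Measure.map_apply hYpo hB, withDensity_apply _ hS,
      Measure.restrict_restrict hS, lintegral_restrict_eq_condExp hm (hS.inter hAm) g hg]
    have hci := (condIndepFun_iff_condExp_inter_preimage_eq_mul hYpo (hD.prodMk hZ)).1 hexch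
      B {(1, 1)} hB (measurableSet_singleton _)
    have h1 : ∫⁻ ω, ENNReal.ofReal ((μ⟦Ypo ⁻¹' B ∩ A | MeasurableSpace.comap X inferInstance⟧) ω) * g ω ∂μ
        = ∫⁻ ω, ENNReal.ofReal ((μ⟦Ypo ⁻¹' B | MeasurableSpace.comap X inferInstance⟧) ω) * 1 ∂μ := by
      refine lintegral_congr_ae ?_
      rw [hDZ] at hpiscore
      filter_upwards [hci, hpiscore, hpos] with ω h2 h3 h4
      obtain ⟨h5, -, h6, -⟩ := h4
      have h7 : 0 < e (X ω) * pi (X ω) := mul_pos h5 h6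
      have h8 : (μ⟦Ypo ⁻¹' B ∩ A | MeasurableSpace.comap X inferInstance⟧) ω
          = (μ⟦Ypo ⁻¹' B | MeasurableSpace.comap X inferInstance⟧) ω * (e (X ω) * pi (X ω)) := by
        rw [← h3]; exact h2
      rw [h8, ENNReal.ofReal_mul' h7.le, mul_assoc, ← ENNReal.ofReal_mul h7.le,
        mul_inv_cancel₀ h7.ne', ENNReal.ofReal_one]
    rw [h1, ← lintegral_restrict_eq_condExp hm hS (fun _ => 1) measurable_const]
    simp
  have hid : ∀ ν : Measure Ω, ∫ ω, Ypo ω ∂ν = ∫ y, y ∂(ν.map Ypo) := fun ν =>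
    (integral_map hYpo.aemeasurable aestronglyMeasurable_id).symm
  rw [hid μ, ← hlaw, ← hid, integral_withDensity_eq_integral_toReal_smul hgm
    (ae_of_all _ fun ω => ENNReal.ofReal_lt_top), ← integral_indicator hAm]
  refine integral_congr_ae ?_
  filter_upwards [hpos] with ω h4
  obtain ⟨h5, -, h6, -⟩ := h4
  have h7 : 0 < e (X ω) * pi (X ω) := mul_pos h5 h6
  have h9 : D ω * Z ω = A.indicator (fun _ => (1 : ℝ)) ω := congrFun hDZ ω
  rw [h9]
  by_cases h : ω ∈ A
  · have h' : D ω = 1 ∧ Z ω = 1 := by simpa [hA] using h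
    simp only [Set.indicator_of_mem h, hcons ω h'.1 h'.2, g, smul_eq_mul,
      ENNReal.toReal_ofReal (inv_pos.2 h7).le, one_div]
  · simp [Set.indicator_of_notMem h]
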